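/- The standard inclusions among recovery classes hold and are proper for MC-histories: every strict MC-history is ACA, every ACA MC-history is recoverable, and moreover there exists a recoverable MC-history that is not ACA, and there exists an ACA MC-history that is not strict. -/

import Mathlib

/-! ## Formalization of MC-transactions and MC-histories
(Pfeifer & Lockemann, "Theory and Practice of Transactional Method Caching") -/

/-- Types of operations: read, write, method, commit, abort. -/
inductive OpKind : Type where
  | r | w | m | c | a
deriving DecidableEq

/-- Operations of MC-histories over data elements of type `D`:
`read i j x` is `r_i^j[x]`, `write i x` is `w_i[x]`, `meth i k l` is `m_i^{k,l}`,
`commit i` is `c_i` and `abort i` is `a_i`. -/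
inductive MCOp (D : Type) : Type where
  | read  (i j : ℕ) (x : D)
  | write (i : ℕ) (x : D)
  | meth  (i k l : ℕ)
  | commit (i : ℕ)
  | abort (i : ℕ)

namespace MCOp
variable {D : Type}

/-- The index of the transaction an operation belongs to. -/
def tx : MCOp D → ℕ
  | read i _ _ => i
  | write i _ => i
  | meth i _ _ => i
  | commit i => i
  | abort i => i

/-- The type `a(p)` of an operation. -/
def kind : MCOp D → OpKind
  | read _ _ _ => .r
  | write _ _ => .w
  | meth _ _ _ => .m
  | commit _ => .c
  | abort _ => .a

end MCOp

/-- The set `d(p)` of data elements of an operation (relative to a history's operation set,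
which is needed for method operations). -/
def dset {D : Type} (ops : Set (MCOp D)) : MCOp D → Set D
  | .read _ _ x => {x}
  | .write _ x => {x}
  | .meth _ k l => {x | MCOp.read k l x ∈ ops}
  | .commit _ => ∅
  | .abort _ => ∅

/-- Two operations conflict (`u ∦ v`). -/
def conflict {D : Type} (ops : Set (MCOp D)) (p q : MCOp D) : Prop :=
  (dset ops p ∩ dset ops q).Nonempty ∧
  ((p.tx ≠ q.tx ∧ (p.kind = OpKind.w ∨ q.kind = OpKind.w)) ∨
   (p.kind = OpKind.w ∧ q.kind = OpKind.m) ∨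
   (p.kind = OpKind.m ∧ q.kind = OpKind.w))

theorem dset_nonmeth {D : Type} (ops1 ops2 : Set (MCOp D)) (p : MCOp D)
    (h : p.kind ≠ OpKind.m) : dset ops1 p = dset ops2 p := by
  cases p <;> simp [dset, MCOp.kind] at *

theorem conflict_nonmeth {D : Type} (ops1 ops2 : Set (MCOp D)) (p q : MCOp D)
    (hp : p.kind ≠ OpKind.m) (hq : q.kind ≠ OpKind.m) :
    conflict ops1 p q → conflict ops2 p q := by
  rintro ⟨h1, h2⟩
  refine ⟨?_, h2⟩
  rwa [dset_nonmeth ops1 ops2 p hp, dset_nonmeth ops1 ops2 q hq] at h1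

/-- A (well defined) MC-history `H` over MC-transactions `T_1, …, T_n`.
The transaction `T_i` is the set of operations `p ∈ ops` with `p.tx = i`;
`lt` is the partial order `<` of the history (by `lt_mem` it only relates
operations of the history and it restricts to the orders `<_i`). -/
structure MCHistory (D : Type) : Type where
  /-- number of transactions -/
  n : ℕ
  /-- the operations of the history -/
  ops : Set (MCOp D)
  /-- the partial ordering relation `<` -/
  lt : MCOp D → MCOp D → Prop
  tx_mem : ∀ p ∈ ops, 1 ≤ p.tx ∧ p.tx ≤ n
  lt_irrefl : ∀ p, ¬ lt p p
  lt_trans : ∀ p q r, lt p q → lt q r → lt p r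
  lt_mem : ∀ p q, lt p q → p ∈ ops ∧ q ∈ ops
  /-- `a_i ∈ T_i ↔ c_i ∉ T_i` -/
  abort_commit : ∀ i, 1 ≤ i → i ≤ n → (MCOp.abort i ∈ ops ↔ MCOp.commit i ∉ ops)
  /-- every non-termination operation precedes `a_i` or `c_i` -/
  terminate : ∀ p ∈ ops, p.kind ≠ OpKind.c → p.kind ≠ OpKind.a →
      lt p (MCOp.abort p.tx) ∨ lt p (MCOp.commit p.tx)
  /-- `r_i^j[x] <_i w_i[x] ↔ ¬ (w_i[x] <_i r_i^j[x])` -/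
  rw_order : ∀ (i j : ℕ) (x : D), MCOp.read i j x ∈ ops → MCOp.write i x ∈ ops →
      (lt (MCOp.read i j x) (MCOp.write i x) ↔ ¬ lt (MCOp.write i x) (MCOp.read i j x))
  /-- for `m_i^{k,l} ∈ H`, `k ∈ {1,…,n}` -/
  meth_range : ∀ i k l, MCOp.meth i k l ∈ ops → 1 ≤ k ∧ k ≤ n
  /-- for `m_i^{k,l} ∈ H`, every `r_k^l[x] ∈ H` satisfies `r_k^l[x] < m_i^{k,l}` -/
  meth_reads : ∀ i k l, MCOp.meth i k l ∈ ops → ∀ x : D, MCOp.read k l x ∈ ops →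
      lt (MCOp.read k l x) (MCOp.meth i k l)
  /-- well definedness: conflicting operations are ordered -/
  well_defined : ∀ p ∈ ops, ∀ q ∈ ops, conflict ops p q → lt p q ∨ lt q p

namespace MCHistory
variable {D : Type}

/-- The rw-projection `RW(H)`: all operations of `H` except method operations,
with the order restricted accordingly. -/
def RW (H : MCHistory D) : MCHistory D where
  n := H.n
  ops := {p | p ∈ H.ops ∧ p.kind ≠ OpKind.m}
  lt := fun p q => H.lt p q ∧ p.kind ≠ OpKind.m ∧ q.kind ≠ OpKind.m
  tx_mem := fun p hp => H.tx_mem p hp.1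
  lt_irrefl := fun p h => H.lt_irrefl p h.1
  lt_trans := fun p q r h1 h2 => ⟨H.lt_trans p q r h1.1 h2.1, h1.2.1, h2.2.2⟩
  lt_mem := fun p q h => ⟨⟨(H.lt_mem p q h.1).1, h.2.1⟩, (H.lt_mem p q h.1).2, h.2.2⟩
  abort_commit := by
    intro i h1 h2
    have h := H.abort_commit i h1 h2
    constructor
    · intro hp hc
      exact (h.mp hp.1) hc.1
    · intro hp
      refine ⟨h.mpr fun hc => hp ⟨hc, ?_⟩, ?_⟩ <;> simp [MCOp.kind]
  terminate := by
    intro p hp hc ha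
    rcases H.terminate p hp.1 hc ha with h | h
    · exact Or.inl ⟨h, hp.2, by simp [MCOp.kind]⟩
    · exact Or.inr ⟨h, hp.2, by simp [MCOp.kind]⟩
  rw_order := by
    intro i j x hr hw
    have h := H.rw_order i j x hr.1 hw.1
    constructor
    · intro hlt hlt2
      exact (h.mp hlt.1) hlt2.1
    · intro hlt
      refine ⟨h.mpr fun h2 => hlt ⟨h2, ?_, ?_⟩, ?_, ?_⟩ <;> simp [MCOp.kind]
  meth_range := by
    intro i k l hm
    exact absurd rfl hm.2
  meth_reads := by
    intro i k l hm
    exact absurd rfl hm.2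
  well_defined := by
    intro p hp q hq hc
    have hc' : conflict H.ops p q := conflict_nonmeth _ _ p q hp.2 hq.2 hc
    rcases H.well_defined p hp.1 q hq.1 hc' with h | h
    · exact Or.inl ⟨h, hp.2, hq.2⟩
    · exact Or.inr ⟨h, hq.2, hp.2⟩

/-- `reads(T_i, x, T_j, p)`: transaction `T_i` reads `x` from `T_j` via the operation `p`. -/
def readsVia (H : MCHistory D) (i : ℕ) (x : D) (j : ℕ) (p : MCOp D) : Prop :=
  ∃ h k : ℕ, MCOp.read h k x ∈ H.ops ∧ MCOp.write j x ∈ H.ops ∧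
    H.lt (MCOp.write j x) (MCOp.read h k x) ∧
    ((h = i ∧ p = MCOp.read h k x) ∨
      (h ≠ i ∧ MCOp.meth i h k ∈ H.ops ∧ p = MCOp.meth i h k)) ∧
    ¬ H.lt (MCOp.abort j) (MCOp.read h k x) ∧
    ∀ o : ℕ, MCOp.write o x ∈ H.ops → H.lt (MCOp.write j x) (MCOp.write o x) →
      H.lt (MCOp.write o x) (MCOp.read h k x) →
      H.lt (MCOp.abort o) (MCOp.read h k x)

/-- `H` is recoverable. -/
def Recoverable (H : MCHistory D) : Prop :=
  ∀ (i j : ℕ) (x : D) (p : MCOp D), i ≠ j → H.readsVia i x j p →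
    MCOp.commit i ∈ H.ops → H.lt (MCOp.commit j) (MCOp.commit i)

/-- `H` avoids cascading aborts (ACA). -/
def ACA (H : MCHistory D) : Prop :=
  ∀ (i j : ℕ) (x : D) (p : MCOp D), i ≠ j → H.readsVia i x j p →
    H.lt (MCOp.commit j) p

/-- `H` is strict. -/
def Strict (H : MCHistory D) : Prop :=
  H.ACA ∧ ∀ (i j : ℕ) (x : D), MCOp.write i x ∈ H.ops → MCOp.write j x ∈ H.ops →
    i ≠ j → H.lt (MCOp.write j x) (MCOp.write i x) →
    (H.lt (MCOp.abort j) (MCOp.write i x) ∨ H.lt (MCOp.commit j) (MCOp.write i x))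

/-- The 1-version serializability graph `SG(H)` of an rw-history. -/
def SG (H : MCHistory D) (i j : ℕ) : Prop :=
  i ≠ j ∧ MCOp.commit i ∈ H.ops ∧ MCOp.commit j ∈ H.ops ∧
  ∃ p q : MCOp D, p ∈ H.ops ∧ q ∈ H.ops ∧ p.tx = i ∧ q.tx = j ∧
    conflict H.ops p q ∧ H.lt p q

/-- The MC-serializability graph `MCSG(H)`. -/
def MCSG (H : MCHistory D) (i j : ℕ) : Prop :=
  MCOp.commit i ∈ H.ops ∧ MCOp.commit j ∈ H.ops ∧
  ((∃ p q : MCOp D, p ∈ H.ops ∧ q ∈ H.ops ∧ p.tx = i ∧ q.tx = j ∧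
      p.kind ≠ OpKind.m ∧ q.kind ≠ OpKind.m ∧ conflict H.ops p q ∧ H.lt p q) ∨
   (∃ (k l : ℕ) (x : D), MCOp.meth i k l ∈ H.ops ∧ MCOp.write j x ∈ H.ops ∧
      MCOp.read k l x ∈ H.ops ∧ H.lt (MCOp.read k l x) (MCOp.write j x) ∧
      (i ≠ j ∨ H.lt (MCOp.write j x) (MCOp.meth i k l))) ∨
   (i ≠ j ∧ ∃ (k l : ℕ) (x : D), MCOp.write i x ∈ H.ops ∧ MCOp.meth j k l ∈ H.ops ∧
      MCOp.read k l x ∈ H.ops ∧ H.lt (MCOp.write i x) (MCOp.read k l x)))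

/-- `ts` is a timestamp function for `H`: it assigns pairwise distinct
natural numbers to the transactions of `H`. -/
def TimestampFn (H : MCHistory D) (ts : ℕ → ℕ) : Prop :=
  ∀ i j : ℕ, 1 ≤ i → i ≤ H.n → 1 ≤ j → j ≤ H.n → ts i = ts j → i = j

/-- `H` is t-ordered w.r.t. `ts`. -/
def TOrdered (H : MCHistory D) (ts : ℕ → ℕ) : Prop :=
  ∀ p ∈ H.ops, ∀ q ∈ H.ops, conflict H.ops p q → ts p.tx < ts q.tx →
    (MCOp.abort p.tx ∈ H.ops ∨ MCOp.abort q.tx ∈ H.ops ∨ H.lt p q)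

/-- `H` is rm-ordered w.r.t. `ts`. -/
def RMOrdered (H : MCHistory D) (ts : ℕ → ℕ) : Prop :=
  ∀ (i j k l : ℕ) (x : D), MCOp.write i x ∈ H.ops → MCOp.meth j k l ∈ H.ops →
    MCOp.read k l x ∈ H.ops →
    H.lt (MCOp.write i x) (MCOp.read k l x) →
    H.lt (MCOp.read k l x) (MCOp.meth j k l) →
    (MCOp.abort i ∈ H.ops ∨ MCOp.abort j ∈ H.ops ∨ ts i < ts j)

/-- `H` is irreflexive. -/
def IrreflexiveHist (H : MCHistory D) : Prop :=
  ∀ (i k l : ℕ) (x : D), MCOp.write i x ∈ H.ops → MCOp.meth i k l ∈ H.ops →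
    MCOp.read k l x ∈ H.ops →
    H.lt (MCOp.read k l x) (MCOp.write i x) →
    H.lt (MCOp.write i x) (MCOp.meth i k l) →
    MCOp.abort i ∈ H.ops

/-- `tsfit` satisfies the defining recursion of the fitting timestamp function
`ts_fit` on the committed transactions of `H`. -/
def TsFitSpec (H : MCHistory D) (ts tsfit : ℕ → ℕ) : Prop :=
  ∀ i : ℕ, MCOp.commit i ∈ H.ops →
    tsfit i = sInf (({ts i} : Set ℕ) ∪
      {v : ℕ | ∃ j : ℕ, MCOp.commit j ∈ H.ops ∧ ts j < ts i ∧
        (∃ (k l : ℕ) (x : D), MCOp.write j x ∈ H.ops ∧ MCOp.meth i k l ∈ H.ops ∧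
          MCOp.read k l x ∈ H.ops ∧ H.lt (MCOp.read k l x) (MCOp.write j x)) ∧
        v = tsfit j})

/-- `H` is t-fitting w.r.t. `ts` (with fitting timestamps `tsfit`). -/
def TFitting (H : MCHistory D) (ts tsfit : ℕ → ℕ) : Prop :=
  ∀ i j : ℕ, H.MCSG i j → ts i < ts j → ts i < tsfit j

/-- A reverse edge of `MCSG(H)` w.r.t. `ts`. -/
def RevEdge (H : MCHistory D) (ts : ℕ → ℕ) (i j : ℕ) : Prop :=
  H.MCSG i j ∧ ts j < ts i

end MCHistory

namespace MCOp
variable {D : Type}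

theorem tx_read (i j : ℕ) (x : D) : (read i j x).tx = i := rfl

theorem tx_write (i : ℕ) (x : D) : (write i x).tx = i := rfl

theorem kind_read (i j : ℕ) (x : D) : (read i j x).kind = OpKind.r := rfl

theorem kind_write (i : ℕ) (x : D) : (write i x).kind = OpKind.w := rfl

end MCOp

namespace MCHistory
variable {D : Type}

theorem lt_commit_of_commit_mem (H : MCHistory D) {p : MCOp D} (hp : p ∈ H.ops)
    (hc : p.kind ≠ OpKind.c) (ha : p.kind ≠ OpKind.a) (hcom : MCOp.commit p.tx ∈ H.ops) :
    H.lt p (MCOp.commit p.tx) := by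
  obtain ⟨h1, h2⟩ := H.tx_mem p hp
  exact (H.terminate p hp hc ha).resolve_left fun h =>
    (H.abort_commit p.tx h1 h2).mp (H.lt_mem _ _ h).2 hcom

theorem ACA.recoverable {H : MCHistory D} (hH : H.ACA) : H.Recoverable := by
  intro i j x p hij hr hci
  have hlt := hH i j x p hij hr
  refine H.lt_trans _ _ _ hlt ?_
  obtain ⟨h, k, -, -, -, ⟨rfl, rfl⟩ | ⟨-, -, rfl⟩, -⟩ := hr
  all_goals
    exact H.lt_commit_of_commit_mem (H.lt_mem _ _ hlt).2 (by simp [MCOp.kind])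
      (by simp [MCOp.kind]) hci

/-- `SeqLt f q r` means that `q` occurs before `r` in the sequence `f`. -/
def SeqLt {m : ℕ} (f : Fin m → MCOp D) (q r : MCOp D) : Prop :=
  ∃ a b, a < b ∧ f a = q ∧ f b = r

section SeqLt
variable {m : ℕ} {f : Fin m → MCOp D} {q r s : MCOp D}

theorem SeqLt.irrefl (hf : Function.Injective f) : ¬ SeqLt f q q := by
  rintro ⟨a, b, hab, rfl, h⟩
  exact hab.ne' (hf h)

theorem SeqLt.trans (hf : Function.Injective f) :
    SeqLt f q r → SeqLt f r s → SeqLt f q s := by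
  rintro ⟨a, b, hab, rfl, rfl⟩ ⟨c, d, hcd, hcb, rfl⟩
  obtain rfl := hf hcb
  exact ⟨a, d, hab.trans hcd, rfl, rfl⟩

theorem SeqLt.total (hq : q ∈ Set.range f) (hr : r ∈ Set.range f) (hne : q ≠ r) :
    SeqLt f q r ∨ SeqLt f r q := by
  obtain ⟨a, rfl⟩ := hq
  obtain ⟨b, rfl⟩ := hr
  rcases lt_trichotomy a b with h | rfl | h
  · exact Or.inl ⟨a, b, h, rfl, rfl⟩
  · exact absurd rfl hne
  · exact Or.inr ⟨b, a, h, rfl, rfl⟩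

end SeqLt

/-- The sequence `w_1[0]`, `p`, `c_1`, `c_2`. -/
def interleavedSeq (p : MCOp ℕ) : Fin 4 → MCOp ℕ :=
  ![.write 1 0, p, .commit 1, .commit 2]

theorem mem_range_interleavedSeq {p q : MCOp ℕ} : q ∈ Set.range (interleavedSeq p) ↔
    q = .write 1 0 ∨ q = p ∨ q = .commit 1 ∨ q = .commit 2 := by
  simp [interleavedSeq, @eq_comm _ q, or_comm, or_assoc, or_left_comm]

theorem interleavedSeq_injective {p : MCOp ℕ} (htx : p.tx = 2) (hc : p.kind ≠ OpKind.c) :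
    Function.Injective (interleavedSeq p) := by
  have h0 : p ≠ .write 1 0 := by rintro rfl; simp [MCOp.tx] at htx
  have h1 : p ≠ .commit 1 := by rintro rfl; exact hc rfl
  have h2 : p ≠ .commit 2 := by rintro rfl; exact hc rfl
  intro a b hab
  fin_cases a <;> fin_cases b <;> first
    | rfl
    | simp [interleavedSeq, h0, h1, h2, h0.symm, h1.symm, h2.symm] at hab

/-- The totally ordered history executing `w_1[0]`, `p`, `c_1`, `c_2` in this sequence, where `p` is
a read or write operation of `T_2`. -/
def interleaved (p : MCOp ℕ) (htx : p.tx = 2) (hp : p.kind = OpKind.r ∨ p.kind = OpKind.w) :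
    MCHistory ℕ :=
  have hf := interleavedSeq_injective htx (by rcases hp with h | h <;> simp [h])
  have no_meth : ∀ i k l, MCOp.meth i k l ∉ Set.range (interleavedSeq p) := by
    intro i k l h
    rw [mem_range_interleavedSeq] at h
    obtain rfl : MCOp.meth i k l = p := by simpa using h
    simp [MCOp.kind] at hp
  { n := 2
    ops := Set.range (interleavedSeq p)
    lt := SeqLt (interleavedSeq p)
    tx_mem := by
      intro q hq
      rw [mem_range_interleavedSeq] at hq
      obtain rfl | rfl | rfl | rfl := hq
      · simp [MCOp.tx]
      · simp [htx]
      · simp [MCOp.tx]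
      · simp [MCOp.tx]
    lt_irrefl := fun _ => SeqLt.irrefl hf
    lt_trans := fun _ _ _ => SeqLt.trans hf
    lt_mem := by
      rintro _ _ ⟨a, b, -, rfl, rfl⟩
      exact ⟨⟨a, rfl⟩, ⟨b, rfl⟩⟩
    abort_commit := by
      intro i h1 h2
      have hc : MCOp.commit i ∈ Set.range (interleavedSeq p) := by
        obtain rfl | rfl : i = 1 ∨ i = 2 := by omega
        · exact ⟨2, rfl⟩
        · exact ⟨3, rfl⟩
      refine iff_of_false (fun h => ?_) (not_not_intro hc)
      rw [mem_range_interleavedSeq] at h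
      obtain rfl : MCOp.abort i = p := by simpa using h
      simp [MCOp.kind] at hp
    terminate := by
      intro q hq hc _
      right
      rw [mem_range_interleavedSeq] at hq
      obtain rfl | rfl | rfl | rfl := hq
      · exact ⟨0, 2, by decide, rfl, rfl⟩
      · exact ⟨1, 3, by decide, rfl, congrArg MCOp.commit htx.symm⟩
      · exact absurd rfl hc
      · exact absurd rfl hc
    rw_order := fun _ _ _ hr hw =>
      ⟨fun h h' => SeqLt.irrefl hf (h.trans hf h'),
        fun h => (SeqLt.total hr hw (by simp)).resolve_right h⟩
    meth_range := fun i k l h => absurd h (no_meth i k l)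
    meth_reads := fun i k l h => absurd h (no_meth i k l)
    well_defined := by
      intro q hq r hr hqr
      refine SeqLt.total hq hr ?_
      rintro rfl
      obtain ⟨-, ⟨h, -⟩ | ⟨h, h'⟩ | ⟨h, h'⟩⟩ := hqr
      · exact h rfl
      all_goals simp [h] at h' }

section interleaved
variable {p : MCOp ℕ} {htx : p.tx = 2} {hp : p.kind = OpKind.r ∨ p.kind = OpKind.w}

theorem mem_ops_interleaved {q : MCOp ℕ} : q ∈ (interleaved p htx hp).ops ↔
    q = .write 1 0 ∨ q = p ∨ q = .commit 1 ∨ q = .commit 2 :=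
  mem_range_interleavedSeq

theorem write_lt_interleaved : (interleaved p htx hp).lt (.write 1 0) p :=
  ⟨0, 1, by decide, rfl, rfl⟩

theorem lt_commit_interleaved : (interleaved p htx hp).lt p (.commit 1) :=
  ⟨1, 2, by decide, rfl, rfl⟩

theorem commit_lt_commit_interleaved : (interleaved p htx hp).lt (.commit 1) (.commit 2) :=
  ⟨2, 3, by decide, rfl, rfl⟩

theorem not_commit_lt_interleaved : ¬ (interleaved p htx hp).lt (.commit 1) p := fun h =>
  lt_irrefl _ _ (lt_trans _ _ _ _ h lt_commit_interleaved)

end interleaved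

theorem exists_recoverable_not_ACA : ∃ H : MCHistory ℕ, H.Recoverable ∧ ¬ H.ACA := by
  refine ⟨interleaved (.read 2 1 0) (MCOp.tx_read ..) (.inl (MCOp.kind_read ..)), ?_, fun h => ?_⟩
  · rintro i j x p - ⟨h, k, hr, hw, -, hip, -⟩ -
    simp only [mem_ops_interleaved, MCOp.read.injEq, MCOp.write.injEq, reduceCtorEq, or_false,
      false_or, false_and, and_false] at hr hw hip
    obtain ⟨rfl, -⟩ := hip
    obtain ⟨rfl, -⟩ := hr
    obtain ⟨rfl, -⟩ := hw
    exact commit_lt_commit_interleaved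
  · refine not_commit_lt_interleaved (h 2 1 0 _ (by decide) ⟨2, 1, ?_, ?_, write_lt_interleaved,
      Or.inl ⟨rfl, rfl⟩, fun ha => ?_, fun o ho hlt => ?_⟩)
    · simp [mem_ops_interleaved]
    · simp [mem_ops_interleaved]
    · simpa [mem_ops_interleaved] using (lt_mem _ _ _ ha).1
    · obtain rfl : o = 1 := by simpa [mem_ops_interleaved] using ho
      exact absurd hlt (lt_irrefl _ _)

theorem exists_ACA_not_strict : ∃ H : MCHistory ℕ, H.ACA ∧ ¬ H.Strict := by
  refine ⟨interleaved (.write 2 0) (MCOp.tx_write ..) (.inr (MCOp.kind_write ..)), ?_, fun h => ?_⟩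
  · rintro i j x p - ⟨h, k, hr, -⟩
    simp [mem_ops_interleaved] at hr
  · rcases h.2 2 1 0 (by simp [mem_ops_interleaved]) (by simp [mem_ops_interleaved]) (by decide)
      write_lt_interleaved with ha | hc
    · simpa [mem_ops_interleaved] using (lt_mem _ _ _ ha).1
    · exact not_commit_lt_interleaved hc

end MCHistory

/-- The recovery classes for MC-histories form a proper hierarchy:
strict ⊂ ACA ⊂ recoverable. -/
theorem strict_subset_aca_subset_recoverable :
    (∀ (D : Type) (H : MCHistory D), H.Strict → H.ACA) ∧
    (∀ (D : Type) (H : MCHistory D), H.ACA → H.Recoverable) ∧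
    (∃ H : MCHistory ℕ, H.Recoverable ∧ ¬ H.ACA) ∧
    (∃ H : MCHistory ℕ, H.ACA ∧ ¬ H.Strict) := by
  exact ⟨fun _ _ h => h.1, fun _ _ h => h.recoverable, MCHistory.exists_recoverable_not_ACA,
    MCHistory.exists_ACA_not_strict⟩
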